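/- Let G ≅ ⊕_{i=1}^{k} (ℤ/q_i)^{n_i} be a finite abelian group of odd order, where q₁,…,q_k are distinct odd prime powers (powers of possibly equal primes but distinct values) and n_i ≥ 1. Then there are exactly 2^k equivalence classes of non-degenerate quadratic forms on G (equivalently, of metric group structures (G,q) up to isomorphism). -/

import Mathlib

namespace MetricGroup

open Finset

/-- Non-degenerate quadratic forms on an abelian group with values in the circle. -/
structure IsMetric {G : Type*} [AddCommGroup G] (f : G → Circle) : Prop where
  zsmul : ∀ (m : ℤ) (g : G), f (m • g) = f g ^ (m ^ 2)
  biadd : ∀ g h c : G, f (g + h) * f c * (f (g + h + c))⁻¹ =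
    (f g * f c * (f (g + c))⁻¹) * (f h * f c * (f (h + c))⁻¹)
  nondeg : ∀ g : G, (∀ h, f g * f h * (f (g + h))⁻¹ = 1) → g = 0

/-- The polarization of a circle-valued function. -/
noncomputable def polar {G : Type*} [AddCommGroup G] (f : G → Circle) (g h : G) : Circle :=
  f (g + h) * (f g)⁻¹ * (f h)⁻¹

section Polar

variable {G : Type*} [AddCommGroup G] {f : G → Circle}

lemma polar_comm (f : G → Circle) (g h : G) : polar f g h = polar f h g := by
  unfold polar; rw [add_comm g h, mul_right_comm]

lemma map_add_eq (f : G → Circle) (g h : G) : f (g + h) = f g * f h * polar f g h := by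
  rw [polar, mul_assoc (f (g + h)), ← mul_inv, mul_left_comm, mul_inv_cancel, mul_one]

lemma IsMetric.map_zero (hf : IsMetric f) : f 0 = 1 := by
  simpa using hf.zsmul 0 0

lemma IsMetric.polar_add_left (hf : IsMetric f) (g h c : G) :
    polar f (g + h) c = polar f g c * polar f h c := by
  have h1 := congrArg (·⁻¹) (hf.biadd g h c)
  simp only [mul_inv, inv_inv] at h1
  unfold polar
  calc f (g + h + c) * (f (g + h))⁻¹ * (f c)⁻¹
      = (f (g + h))⁻¹ * (f c)⁻¹ * f (g + h + c) := by rw [mul_assoc, mul_comm]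
    _ = _ := h1
    _ = _ := by congr 1 <;> rw [mul_comm, mul_assoc]

lemma IsMetric.polar_add_right (hf : IsMetric f) (g h c : G) :
    polar f c (g + h) = polar f c g * polar f c h := by
  rw [polar_comm, hf.polar_add_left, polar_comm f g, polar_comm f h]

/-- The polarization as a homomorphism in its first variable. -/
noncomputable def IsMetric.polarHom (hf : IsMetric f) (c : G) : G →+ Additive Circle :=
  AddMonoidHom.mk' (fun g => Additive.ofMul (polar f g c)) fun g h => by
    rw [hf.polar_add_left, ofMul_mul]

lemma IsMetric.polar_zsmul_left (hf : IsMetric f) (m : ℤ) (g c : G) :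
    polar f (m • g) c = polar f g c ^ m :=
  map_zsmul (hf.polarHom c) m g

lemma IsMetric.polar_nsmul_left (hf : IsMetric f) (m : ℕ) (g c : G) :
    polar f (m • g) c = polar f g c ^ m :=
  map_nsmul (hf.polarHom c) m g

lemma IsMetric.polar_zero_left (hf : IsMetric f) (c : G) : polar f 0 c = 1 :=
  _root_.map_zero (hf.polarHom c)

lemma IsMetric.polar_sum_left (hf : IsMetric f) {T : Type*} (S : Finset T) (x : T → G) (c : G) :
    polar f (∑ t ∈ S, x t) c = ∏ t ∈ S, polar f (x t) c :=
  map_sum (hf.polarHom c) x S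

lemma IsMetric.polar_zsmul_right (hf : IsMetric f) (m : ℤ) (g c : G) :
    polar f c (m • g) = polar f c g ^ m := by
  rw [polar_comm, hf.polar_zsmul_left, polar_comm]

lemma IsMetric.polar_nsmul_right (hf : IsMetric f) (m : ℕ) (g c : G) :
    polar f c (m • g) = polar f c g ^ m := by
  rw [polar_comm, hf.polar_nsmul_left, polar_comm]

lemma IsMetric.polar_sum_right (hf : IsMetric f) {T : Type*} (S : Finset T) (x : T → G) (c : G) :
    polar f c (∑ t ∈ S, x t) = ∏ t ∈ S, polar f c (x t) := by
  rw [polar_comm, hf.polar_sum_left]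
  exact prod_congr rfl fun t _ => polar_comm _ _ _

lemma IsMetric.polar_self (hf : IsMetric f) (g : G) : polar f g g = f g ^ 2 := by
  have h := hf.zsmul 2 g
  rw [two_zsmul, map_add_eq f] at h
  have h4 : f g ^ ((2 : ℤ) ^ 2) = f g * f g * f g ^ 2 := by
    rw [← pow_two, ← pow_add]; exact_mod_cast rfl
  rw [h4] at h
  exact mul_left_cancel h

lemma IsMetric.eq_zero_of_polar (hf : IsMetric f) {g : G} (h : ∀ c, polar f g c = 1) : g = 0 := by
  refine hf.nondeg g fun c => ?_
  rw [map_add_eq f, h c, mul_one, mul_inv_cancel]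

lemma IsMetric.map_sum_of_orthogonal (hf : IsMetric f) {T : Type*} [DecidableEq T] {v : T → G}
    (hv : ∀ t s, t ≠ s → polar f (v t) (v s) = 1) (S : Finset T) (m : T → ℤ) :
    f (∑ t ∈ S, m t • v t) = ∏ t ∈ S, f (v t) ^ (m t ^ 2) := by
  induction S using Finset.induction_on with
  | empty => simpa using hf.map_zero
  | insert a S ha ih =>
    have hpol : ∏ t ∈ S, polar f (m a • v a) (m t • v t) = 1 := prod_eq_one fun t ht => by
      rw [hf.polar_zsmul_left, hf.polar_zsmul_right, hv a t (by rintro rfl; exact ha ht)]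
      simp
    rw [sum_insert ha, prod_insert ha, map_add_eq f, ih, hf.zsmul, hf.polar_sum_right, hpol,
      mul_one]

lemma IsMetric.pow_eq_one_of_nsmul_eq_zero (hf : IsMetric f) {v : G} {N : ℕ} (hN : Odd N)
    (hv : N • v = 0) :
    f v ^ N = 1 := by
  have h1 : f v ^ (N * N) = 1 := by
    have := hf.zsmul N v
    rw [natCast_zsmul, hv, hf.map_zero] at this
    rw [← pow_two]; exact_mod_cast this.symm
  have h2 : f v ^ (2 * N) = 1 := by
    rw [pow_mul, ← hf.polar_self, ← hf.polar_nsmul_left, hv, hf.polar_zero_left]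
  have h3 := pow_gcd_eq_one.mpr ⟨h1, h2⟩
  rwa [Nat.gcd_mul_right, (Nat.coprime_two_right.mpr hN).gcd_eq_one, one_mul] at h3

lemma polar_comp_equiv {H : Type*} [AddCommGroup H] (f : G → Circle) (φ : H ≃+ G) (g h : H) :
    polar (fun x => f (φ x)) g h = polar f (φ g) (φ h) := by
  simp [polar]

end Polar

section Arithmetic

lemma exists_sq_mul_eq_one {p : ℕ} (hodd : Odd p) (l : ℕ) {c : ℤ}
    (hc : (p : ℤ) ∣ c - 1) : ∃ s : ℤ, ((p ^ (l + 1) : ℕ) : ℤ) ∣ s ^ 2 * c - 1 := by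
  obtain ⟨h, hh⟩ := hodd.pow (n := l)
  refine ⟨c ^ h, ?_⟩
  have := dvd_sub_pow_of_dvd_sub hc l
  rw [one_pow, hh] at this
  rw [← pow_mul, ← pow_succ, mul_comm h]
  exact_mod_cast this

lemma exists_inv_mod {p : ℕ} (hp : p.Prime) (l : ℕ) {c : ℤ} (hc : ¬ (p : ℤ) ∣ c) :
    ∃ d : ℤ, ((p ^ l : ℕ) : ℤ) ∣ c * d - 1 := by
  have hcop : IsCoprime c ((p ^ l : ℕ) : ℤ) := by
    push_cast
    exact (((Nat.prime_iff_prime_int.mp hp).coprime_iff_not_dvd).mpr hc).symm.pow_right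
  obtain ⟨a, b, hab⟩ := hcop
  exact ⟨a, -b, by linear_combination hab⟩

lemma exists_mul_sq_eq {p : ℕ} (hp : p.Prime) (hodd : Odd p) (l : ℕ) {a c w : ℤ}
    (hc : ¬ (p : ℤ) ∣ c) (h : (p : ℤ) ∣ a * w ^ 2 - c) :
    ∃ s : ℤ, ((p ^ (l + 1) : ℕ) : ℤ) ∣ a * s ^ 2 - c := by
  obtain ⟨d, hd⟩ := exists_inv_mod hp (l + 1) hc
  have hpd : (p : ℤ) ∣ c * d - 1 :=
    (Int.natCast_dvd_natCast.mpr (dvd_pow_self p l.succ_ne_zero)).trans hd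
  obtain ⟨s, hs⟩ := exists_sq_mul_eq_one hodd l (c := a * w ^ 2 * d) (by
    have e : a * w ^ 2 * d - 1 = (a * w ^ 2 - c) * d + (c * d - 1) := by ring
    exact e ▸ dvd_add (h.mul_right d) hpd)
  refine ⟨w * s, ?_⟩
  have e : a * (w * s) ^ 2 - c = (s ^ 2 * (a * w ^ 2 * d) - 1) * c -
      (c * d - 1) * (a * w ^ 2 * s ^ 2) := by ring
  exact e ▸ dvd_sub (hs.mul_right c) (hd.mul_right (a * w ^ 2 * s ^ 2))

lemma exists_mul_sq_add_mul_sq_eq_one {p : ℕ} (hp : p.Prime) (hodd : Odd p) (l : ℕ) {a b : ℤ}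
    (ha : ¬ (p : ℤ) ∣ a) (hb : ¬ (p : ℤ) ∣ b) :
    ∃ x y : ℤ, ((p ^ (l + 1) : ℕ) : ℤ) ∣ a * x ^ 2 + b * y ^ 2 - 1 := by
  have := Fact.mk hp
  have ha' : (a : ZMod p) ≠ 0 := by rwa [Ne, ZMod.intCast_zmod_eq_zero_iff_dvd]
  have hb' : (b : ZMod p) ≠ 0 := by rwa [Ne, ZMod.intCast_zmod_eq_zero_iff_dvd]
  obtain ⟨x, y, hxy⟩ := FiniteField.exists_root_sum_quadratic
    (f := .C (a : ZMod p) * .X ^ 2 + .C 0 * .X + .C 0)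
    (g := .C (b : ZMod p) * .X ^ 2 + .C 0 * .X + .C (-1))
    (Polynomial.degree_quadratic ha') (Polynomial.degree_quadratic hb')
    (by rw [ZMod.card]; exact Nat.odd_iff.mp hodd)
  obtain ⟨X, rfl⟩ := ZMod.intCast_surjective x
  obtain ⟨Y, rfl⟩ := ZMod.intCast_surjective y
  have hXY : (p : ℤ) ∣ a * X ^ 2 + b * Y ^ 2 - 1 := by
    rw [← ZMod.intCast_zmod_eq_zero_iff_dvd]
    push_cast
    simp at hxy
    linear_combination hxy
  obtain ⟨s, hs⟩ := exists_sq_mul_eq_one hodd l hXY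
  exact ⟨s * X, s * Y, by convert hs using 1; ring⟩

lemma exists_mul_sq_eq_one_or {p : ℕ} (hp : p.Prime) (hodd : Odd p) (l : ℕ) {a u : ℤ}
    (hu : ¬ IsSquare (u : ZMod p)) (ha : ¬ (p : ℤ) ∣ a) :
    ∃ ε : Bool, ∃ s : ℤ, ¬ (p : ℤ) ∣ s ∧
      ((p ^ (l + 1) : ℕ) : ℤ) ∣ a * s ^ 2 - (if ε then u else 1) := by
  have := Fact.mk hp
  have ha' : (a : ZMod p) ≠ 0 := by rwa [Ne, ZMod.intCast_zmod_eq_zero_iff_dvd]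
  have hu' : (u : ZMod p) ≠ 0 := by rintro h; exact hu (h ▸ IsSquare.zero)
  have key : ∀ c : ℤ, (c : ZMod p) ≠ 0 → IsSquare ((c : ZMod p) * a) →
      ∃ s : ℤ, ¬ (p : ℤ) ∣ s ∧ ((p ^ (l + 1) : ℕ) : ℤ) ∣ a * s ^ 2 - c := by
    rintro c hc ⟨r, hr⟩
    have hc' : ¬ (p : ℤ) ∣ c := by rwa [← ZMod.intCast_zmod_eq_zero_iff_dvd]
    obtain ⟨w, hw⟩ := ZMod.intCast_surjective (r / (a : ZMod p))
    obtain ⟨s, hs⟩ := exists_mul_sq_eq hp hodd l (a := a) (w := w) hc' (by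
      rw [← ZMod.intCast_zmod_eq_zero_iff_dvd]
      push_cast
      rw [hw]
      field_simp
      linear_combination -hr)
    refine ⟨s, fun hps => hc' ?_, hs⟩
    have h1 : (p : ℤ) ∣ a * s ^ 2 - c :=
      (Int.natCast_dvd_natCast.mpr (dvd_pow_self p l.succ_ne_zero)).trans hs
    have h2 : (p : ℤ) ∣ a * s ^ 2 := (hps.pow two_ne_zero).mul_left a
    simpa using dvd_sub h2 h1
  by_cases hsq : IsSquare (a : ZMod p)
  · exact ⟨false, by simpa using key 1 (by simp) (by simpa using hsq)⟩
  · have hua : IsSquare ((u : ZMod p) * a) := by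
      rw [← quadraticChar_one_iff_isSquare (mul_ne_zero hu' ha'), map_mul,
        quadraticChar_neg_one_iff_not_isSquare.mpr hu,
        quadraticChar_neg_one_iff_not_isSquare.mpr hsq]
      rfl
    exact ⟨true, by simpa using key u hu' hua⟩

lemma exists_int_not_isSquare {p : ℕ} (hp : p.Prime) (hodd : Odd p) :
    ∃ u : ℤ, ¬ IsSquare (u : ZMod p) := by
  have := Fact.mk hp
  obtain ⟨a, ha⟩ := FiniteField.exists_nonsquare (F := ZMod p)
    (by rw [ZMod.ringChar_zmod_n]; rintro rfl; exact absurd hodd (by decide))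
  obtain ⟨u, rfl⟩ := ZMod.intCast_surjective a
  exact ⟨u, ha⟩

lemma exists_addChar_injective (N : ℕ) (hN : N ≠ 0) :
    ∃ χ : AddChar (ZMod N) Circle, Function.Injective χ :=
  haveI := NeZero.mk hN
  ⟨ZMod.toCircle, ZMod.injective_toCircle⟩

lemma isPrimitiveRoot_addChar_one {N : ℕ} {χ : AddChar (ZMod N) Circle}
    (hχ : Function.Injective χ) : IsPrimitiveRoot (χ 1) N := by
  have key : ∀ m : ℕ, χ 1 ^ m = χ (m : ZMod N) := fun m => by
    rw [← AddChar.map_nsmul_eq_pow, nsmul_one]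
  refine ⟨by simp [key], fun m hm => ?_⟩
  rw [key, ← AddChar.map_zero_eq_one χ] at hm
  exact (ZMod.natCast_eq_zero_iff _ _).mp (hχ hm)

lemma exists_pow_eq_of_isPrimitiveRoot {N : ℕ} [NeZero N] {ζ z : Circle}
    (hζ : IsPrimitiveRoot ζ N) (hz : z ^ N = 1) : ∃ m : ℕ, ζ ^ m = z := by
  have h1 : IsPrimitiveRoot (ζ : ℂ) N :=
    hζ.map_of_injective (f := Circle.coeHom) Circle.coe_injective
  obtain ⟨m, -, hm⟩ := h1.eq_pow_of_pow_eq_one (ξ := (z : ℂ))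
    (by exact_mod_cast congrArg Circle.coeHom hz)
  exact ⟨m, Circle.coe_injective (by simpa using hm)⟩

end Arithmetic

section Basis

variable {G T : Type*} [AddCommGroup G]

/-- A generating family whose `t`-th member is killed by `Q t`. In a group of order `∏ t, Q t`
this amounts to a decomposition of `G` as a direct sum of cyclic groups of orders `Q t`. -/
structure IsCyclicBasis (Q : T → ℕ) (v : T → G) : Prop where
  nsmul_eq_zero : ∀ t, Q t • v t = 0
  span_eq_top : Submodule.span ℤ (Set.range v) = ⊤

variable {Q : T → ℕ} {v : T → G}

lemma IsCyclicBasis.of_mem_span (hv : IsCyclicBasis Q v) {w : T → G}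
    (hw : ∀ t, Q t • w t = 0) (h : ∀ t, v t ∈ Submodule.span ℤ (Set.range w)) :
    IsCyclicBasis Q w :=
  ⟨hw, eq_top_iff.mpr (hv.span_eq_top ▸ Submodule.span_le.mpr (Set.range_subset_iff.mpr h))⟩

lemma IsCyclicBasis.zsmul_eq_zero (hv : IsCyclicBasis Q v) {t : T} {m : ℤ}
    (h : (Q t : ℤ) ∣ m) : m • v t = 0 := by
  obtain ⟨c, rfl⟩ := h
  rw [mul_comm, mul_smul, natCast_zsmul, hv.nsmul_eq_zero, smul_zero]

lemma IsCyclicBasis.map {H : Type*} [AddCommGroup H] (hv : IsCyclicBasis Q v) (φ : G ≃+ H) :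
    IsCyclicBasis Q fun t => φ (v t) := by
  refine ⟨fun t => by rw [← map_nsmul, hv.nsmul_eq_zero, map_zero], ?_⟩
  have h := congrArg (Submodule.map φ.toAddMonoidHom.toIntLinearMap) hv.span_eq_top
  rw [Submodule.map_span, ← Set.range_comp, Submodule.map_top, LinearMap.range_eq_top.mpr] at h
  · exact h
  · exact φ.surjective

lemma IsMetric.eq_zero_of_polar_basis {f : G → Circle} (hf : IsMetric f) [Fintype T]
    (hv : IsCyclicBasis Q v) {g : G} (h : ∀ t, polar f g (v t) = 1) : g = 0 := by
  refine hf.eq_zero_of_polar fun c => ?_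
  obtain ⟨m, rfl⟩ := (Submodule.mem_span_range_iff_exists_fun ℤ).mp
    (hv.span_eq_top ▸ Submodule.mem_top : c ∈ Submodule.span ℤ (Set.range v))
  rw [hf.polar_sum_right]
  exact prod_eq_one fun t _ => by rw [hf.polar_zsmul_right, h, one_zpow]

variable [Fintype T]

lemma IsCyclicBasis.exists_eq_sum (hv : IsCyclicBasis Q v) (g : G) :
    ∃ m : T → ℤ, ∑ t, m t • v t = g :=
  (Submodule.mem_span_range_iff_exists_fun ℤ).mp (hv.span_eq_top ▸ Submodule.mem_top)

/-- The homomorphism out of a product of cyclic groups given by a cyclic basis. -/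
noncomputable def IsCyclicBasis.hom (hv : IsCyclicBasis Q v) : (∀ t, ZMod (Q t)) →+ G :=
  ∑ t, (ZMod.lift (Q t) ⟨zmultiplesHom G (v t), by simpa using hv.nsmul_eq_zero t⟩).comp
    (Pi.evalAddMonoidHom _ t)

lemma IsCyclicBasis.hom_intCast (hv : IsCyclicBasis Q v) (m : T → ℤ) :
    hv.hom (fun t => (m t : ZMod (Q t))) = ∑ t, m t • v t := by
  simp [IsCyclicBasis.hom]

lemma IsCyclicBasis.hom_bijective (hv : IsCyclicBasis Q v) [Finite G] (hQ : ∀ t, Q t ≠ 0)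
    (hcard : Nat.card G = ∏ t, Q t) : Function.Bijective hv.hom := by
  have (t : T) : NeZero (Q t) := ⟨hQ t⟩
  have := Fintype.ofFinite G
  classical
  refine (Fintype.bijective_iff_surjective_and_card _).mpr ⟨fun g => ?_, ?_⟩
  · obtain ⟨m, rfl⟩ := hv.exists_eq_sum g
    exact ⟨_, hv.hom_intCast m⟩
  · rw [← Nat.card_eq_fintype_card (α := G), hcard, Fintype.card_pi]
    exact prod_congr rfl fun t _ => ZMod.card _

lemma IsCyclicBasis.sum_eq_zero_iff (hv : IsCyclicBasis Q v) [Finite G] (hQ : ∀ t, Q t ≠ 0)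
    (hcard : Nat.card G = ∏ t, Q t) (m : T → ℤ) :
    ∑ t, m t • v t = 0 ↔ ∀ t, (Q t : ℤ) ∣ m t := by
  rw [← hv.hom_intCast, map_eq_zero_iff _ (hv.hom_bijective hQ hcard).1, funext_iff]
  simp [ZMod.intCast_zmod_eq_zero_iff_dvd]

lemma IsCyclicBasis.zsmul_eq_zero_iff (hv : IsCyclicBasis Q v) [Finite G] (hQ : ∀ t, Q t ≠ 0)
    (hcard : Nat.card G = ∏ t, Q t) (t : T) (m : ℤ) :
    m • v t = 0 ↔ (Q t : ℤ) ∣ m := by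
  refine ⟨fun h => ?_, hv.zsmul_eq_zero⟩
  classical
  have h2 := (hv.sum_eq_zero_iff hQ hcard (Pi.single t m)).mp (by
    rw [sum_eq_single t (fun s _ hs => by simp [hs]) (by simp)]; simpa using h) t
  simpa using h2

end Basis

section Orthogonal

variable {G T : Type*} [AddCommGroup G] [Fintype T] {f : G → Circle}
  {Q p l : T → ℕ} {v : T → G}

/-- Vectors of a family are pairwise orthogonal for the polarization of `f`. -/
def IsOrthogonal (f : G → Circle) (v : T → G) : Prop :=
  ∀ t s, t ≠ s → polar f (v t) (v s) = 1

lemma pow_two_ne_one {z : Circle} {N : ℕ} (hN : Odd N) (h1 : z ^ N = 1) (hz : z ≠ 1) :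
    z ^ 2 ≠ 1 := fun h2 => by
  have h3 := pow_gcd_eq_one.mpr ⟨h1, h2⟩
  rw [(Nat.coprime_two_right.mpr hN).gcd_eq_one, pow_one] at h3
  exact hz h3

lemma isPrimitiveRoot_prime_pow {z : Circle} {p l : ℕ} (hp : p.Prime) (h1 : z ^ p ^ (l + 1) = 1)
    (h2 : z ^ p ^ l ≠ 1) : IsPrimitiveRoot z (p ^ (l + 1)) := by
  have := Fact.mk hp
  exact orderOf_eq_prime_pow h2 h1 ▸ IsPrimitiveRoot.orderOf z

/-- Among the vectors not yet split off, after a change of basis some vector has primitive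
self-pairing. -/
lemma exists_polar_self_primitive [Finite G] (hf : IsMetric f) (hp : ∀ t, (p t).Prime)
    (hodd : ∀ t, Odd (Q t)) (hQ : ∀ t, Q t = p t ^ (l t + 1)) (hcard : Nat.card G = ∏ t, Q t)
    (hv : IsCyclicBasis Q v) {S : Finset T} (hS : S ≠ univ)
    (hvS : ∀ t ∈ S, ∀ s, t ≠ s → polar f (v t) (v s) = 1) :
    ∃ (w : T → G) (r : T), IsCyclicBasis Q w ∧ r ∉ S ∧
      (∀ t ∈ S, ∀ s, t ≠ s → polar f (w t) (w s) = 1) ∧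
      IsPrimitiveRoot (polar f (w r) (w r)) (Q r) := by
  classical
  have hQ0 : ∀ t, Q t ≠ 0 := fun t => (hodd t).pos.ne'
  have hSc : (univ \ S).Nonempty := by
    rw [sdiff_nonempty]; exact fun h => hS (univ_subset_iff.mp h)
  obtain ⟨t, htS, hmax⟩ := exists_max_image (univ \ S) Q hSc
  simp only [mem_sdiff, mem_univ, true_and] at htS hmax
  have hne : p t ^ l t • v t ≠ 0 := by
    rw [← natCast_zsmul, Ne, hv.zsmul_eq_zero_iff hQ0 hcard, hQ t, Int.natCast_dvd_natCast,
      Nat.pow_dvd_pow_iff_le_right (hp t).one_lt]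
    omega
  obtain ⟨s, hs⟩ : ∃ s, polar f (v t) (v s) ^ p t ^ l t ≠ 1 := by
    by_contra! hcon
    exact hne (hf.eq_zero_of_polar_basis hv fun s => by rw [hf.polar_nsmul_left]; exact hcon s)
  have hsS : s ∉ S := fun h => hs <| by
    rw [polar_comm, hvS s h t (by rintro rfl; exact htS h), one_pow]
  have hts : IsPrimitiveRoot (polar f (v t) (v s)) (Q t) := by
    rw [hQ t]
    refine isPrimitiveRoot_prime_pow (hp t) ?_ hs
    rw [← hf.polar_nsmul_left, ← hQ t, hv.nsmul_eq_zero, hf.polar_zero_left]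
  have hQs : Q s = Q t := by
    refine (hmax s hsS).antisymm (Nat.le_of_dvd (hodd s).pos (hts.dvd_of_pow_eq_one _ ?_))
    rw [← hf.polar_nsmul_right, hv.nsmul_eq_zero, polar_comm, hf.polar_zero_left]
  have hself : ∀ (w : T → G) (r : T), Q r = Q t → IsCyclicBasis Q w →
      polar f (w r) (w r) ^ p t ^ l t ≠ 1 → IsPrimitiveRoot (polar f (w r) (w r)) (Q r) := by
    intro w r hr hw h
    rw [hr, hQ t]
    refine isPrimitiveRoot_prime_pow (hp t) ?_ h
    rw [← hf.polar_nsmul_left, ← hQ t, ← hr, hw.nsmul_eq_zero, hf.polar_zero_left]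
  by_cases htt : polar f (v t) (v t) ^ p t ^ l t = 1
  swap
  · exact ⟨v, t, hv, htS, hvS, hself v t rfl hv htt⟩
  by_cases hss : polar f (v s) (v s) ^ p t ^ l t = 1
  swap
  · exact ⟨v, s, hv, hsS, hvS, hself v s hQs hv hss⟩
  have hst : s ≠ t := by rintro rfl; exact hs htt
  have hw : IsCyclicBasis Q (Function.update v t (v t + v s)) := by
    have hmem : ∀ u, Function.update v t (v t + v s) u ∈
        Submodule.span ℤ (Set.range (Function.update v t (v t + v s))) :=
      fun u => Submodule.subset_span ⟨u, rfl⟩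
    refine hv.of_mem_span (fun u => ?_) fun u => ?_
    · rcases eq_or_ne u t with rfl | hu
      · rw [Function.update_self, smul_add, hv.nsmul_eq_zero, ← hQs, hv.nsmul_eq_zero, add_zero]
      · rw [Function.update_of_ne hu, hv.nsmul_eq_zero]
    · rcases eq_or_ne u t with rfl | hu
      · have := Submodule.sub_mem _ (hmem u) (hmem s)
        rwa [Function.update_self, Function.update_of_ne hst, add_sub_cancel_right] at this
      · simpa [Function.update_of_ne hu] using hmem u
  refine ⟨_, t, hw, htS, fun u hu x hux => ?_, hself _ t rfl hw ?_⟩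
  · have hut : u ≠ t := by rintro rfl; exact htS hu
    rw [Function.update_of_ne hut]
    rcases eq_or_ne x t with rfl | hx
    · rw [Function.update_self, hf.polar_add_right, hvS u hu x hut,
        hvS u hu s (by rintro rfl; exact hsS hu), one_mul]
    · rw [Function.update_of_ne hx, hvS u hu x hux]
  · rw [Function.update_self, hf.polar_add_left, hf.polar_add_right, hf.polar_add_right,
      polar_comm f (v s) (v t), mul_pow, mul_pow, mul_pow, htt, hss, one_mul, mul_one, ← pow_two]
    refine pow_two_ne_one (hodd t) ?_ hs
    rw [← pow_mul, mul_comm, pow_mul, hts.pow_eq_one, one_pow]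

theorem exists_orthogonal_basis [Finite G] (hf : IsMetric f) (hp : ∀ t, (p t).Prime)
    (hodd : ∀ t, Odd (Q t)) (hQ : ∀ t, Q t = p t ^ (l t + 1)) (hcard : Nat.card G = ∏ t, Q t)
    (hv : IsCyclicBasis Q v) : ∃ w : T → G, IsCyclicBasis Q w ∧ IsOrthogonal f w := by
  classical
  have hQ0 : ∀ t, NeZero (Q t) := fun t => ⟨(hodd t).pos.ne'⟩
  suffices h : ∀ n ≤ Fintype.card T, ∃ (S : Finset T) (w : T → G), S.card = n ∧
      IsCyclicBasis Q w ∧ ∀ t ∈ S, ∀ s, t ≠ s → polar f (w t) (w s) = 1 by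
    obtain ⟨S, w, hS, hw, h⟩ := h _ le_rfl
    rw [card_eq_iff_eq_univ] at hS
    exact ⟨w, hw, fun t s => h t (hS ▸ mem_univ t) s⟩
  intro n hn
  induction n with
  | zero => exact ⟨∅, v, rfl, hv, by simp⟩
  | succ n ih =>
    obtain ⟨S, v, hS, hv, hvS⟩ := ih (by omega)
    obtain ⟨v, r, hv, hr, hvS, hβ⟩ := exists_polar_self_primitive hf hp hodd hQ hcard hv
      (by rintro rfl; rw [card_univ] at hS; omega) hvS
    have hex : ∀ u, ∃ m : ℕ, polar f (v r) (v r) ^ m = (polar f (v u) (v r))⁻¹ ∧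
        (u ∈ S → m = 0) := by
      intro u
      by_cases hu : u ∈ S
      · exact ⟨0, by rw [hvS u hu r (by rintro rfl; exact hr hu)]; simp, fun _ => rfl⟩
      · obtain ⟨m, hm⟩ := exists_pow_eq_of_isPrimitiveRoot hβ
          (z := (polar f (v u) (v r))⁻¹) (by
            rw [inv_pow, ← hf.polar_nsmul_right, hv.nsmul_eq_zero, polar_comm,
              hf.polar_zero_left, inv_one])
        exact ⟨m, hm, fun h => absurd h hu⟩
    choose m hm hmS using hex
    set w : T → G := fun u => if u = r then v r else v u + m u • v r with hwdef
    have hwr : w r = v r := by simp [hwdef]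
    have hwu : ∀ u, u ≠ r → w u = v u + m u • v r := fun u hu => by simp [hwdef, hu]
    have hmem : ∀ u, w u ∈ Submodule.span ℤ (Set.range w) :=
      fun u => Submodule.subset_span ⟨u, rfl⟩
    have hrw : ∀ u, u ≠ r → polar f (w r) (w u) = 1 := fun u hu => by
      rw [hwr, hwu u hu, hf.polar_add_right, hf.polar_nsmul_right, hm, polar_comm f (v r),
        mul_inv_cancel]
    refine ⟨insert r S, w, by rw [card_insert_of_notMem hr, hS],
      hv.of_mem_span (fun u => ?_) fun u => ?_, fun t ht s hts => ?_⟩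
    · rcases eq_or_ne u r with rfl | hu
      · rw [hwr, hv.nsmul_eq_zero]
      · have hdvd : Q r ∣ m u * Q u := by
          refine hβ.dvd_of_pow_eq_one _ ?_
          rw [pow_mul, hm, inv_pow, ← hf.polar_nsmul_left, hv.nsmul_eq_zero, hf.polar_zero_left,
            inv_one]
        obtain ⟨c, hc⟩ := hdvd
        rw [hwu u hu, smul_add, hv.nsmul_eq_zero, zero_add, ← mul_smul, mul_comm, hc, mul_comm,
          mul_smul, hv.nsmul_eq_zero, smul_zero]
    · rcases eq_or_ne u r with rfl | hu
      · exact hwr ▸ hmem u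
      · have := Submodule.sub_mem _ (hmem u) (nsmul_mem (hmem r) (m u))
        rwa [hwr, hwu u hu, add_sub_cancel_right] at this
    · rcases eq_or_ne t r with rfl | htr
      · exact hrw s hts.symm
      have htS := mem_of_mem_insert_of_ne ht htr
      rcases eq_or_ne s r with rfl | hsr
      · rw [polar_comm, hrw t htr]
      rw [hwu t htr, hmS t htS, zero_smul, add_zero, hwu s hsr, hf.polar_add_right,
        hf.polar_nsmul_right, hvS t htS s hts, hvS t htS r htr, one_pow, one_mul]

end Orthogonal

section DiagonalForms

variable {G T : Type*} [AddCommGroup G] {f g : G → Circle} {Q p l : T → ℕ} {v w : T → G}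

lemma IsCyclicBasis.zsmul (hp : ∀ t, (p t).Prime) (hQ : ∀ t, Q t = p t ^ (l t + 1))
    (hv : IsCyclicBasis Q v) {c : T → ℤ} (hc : ∀ t, ¬ (p t : ℤ) ∣ c t) :
    IsCyclicBasis Q fun t => c t • v t := by
  refine hv.of_mem_span (fun t => ?_) fun t => ?_
  · rw [smul_comm, hv.nsmul_eq_zero, smul_zero]
  · obtain ⟨d, hd⟩ := exists_inv_mod (hp t) (l t + 1) (hc t)
    have h1 := hv.zsmul_eq_zero (t := t) (hQ t ▸ hd)
    rw [sub_smul, one_smul, sub_eq_zero, mul_comm, mul_smul] at h1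
    have h2 := Submodule.smul_mem _ d (Submodule.subset_span (R := ℤ) ⟨t, rfl⟩ :
      c t • v t ∈ Submodule.span ℤ (Set.range fun t => c t • v t))
    rwa [h1] at h2

lemma IsOrthogonal.zsmul (hf : IsMetric f) (hort : IsOrthogonal f v) (c : T → ℤ) :
    IsOrthogonal f fun t => c t • v t := fun t s hts => by
  rw [hf.polar_zsmul_left, hf.polar_zsmul_right, hort t s hts, one_zpow, one_zpow]

/-- A binary form `⟨a, b⟩` with unit coefficients splits off `⟨1⟩`. -/
lemma exists_basis_value_eq (hf : IsMetric f) (hp : ∀ t, (p t).Prime)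
    (hodd : ∀ t, Odd (Q t)) (hQ : ∀ t, Q t = p t ^ (l t + 1))
    (hv : IsCyclicBasis Q v) (hort : IsOrthogonal f v) {t s : T} (hts : t ≠ s) (hQts : Q s = Q t)
    {ζ : Circle} (hζ : IsPrimitiveRoot ζ (Q t)) {a b : ℤ} (hat : f (v t) = ζ ^ a)
    (hbs : f (v s) = ζ ^ b) (ha : ¬ (p t : ℤ) ∣ a) (hb : ¬ (p t : ℤ) ∣ b) :
    ∃ w : T → G, IsCyclicBasis Q w ∧ IsOrthogonal f w ∧ f (w t) = ζ ∧
      ∀ u, u ≠ t → u ≠ s → w u = v u := by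
  classical
  have hpodd : Odd (p t) := Nat.Odd.of_mul_right (m := p t ^ l t)
    (by rw [← pow_succ, ← hQ t]; exact hodd t)
  obtain ⟨x, y, hxy⟩ := exists_mul_sq_add_mul_sq_eq_one (hp t) hpodd (l t) ha hb
  rw [← hQ t] at hxy
  set w : T → G := fun u => if u = t then x • v t + y • v s else
    if u = s then (-(b * y)) • v t + (a * x) • v s else v u with hw
  have hwt : w t = x • v t + y • v s := by simp [hw]
  have hws : w s = (-(b * y)) • v t + (a * x) • v s := by simp [hw, hts.symm]
  have hwu : ∀ u, u ≠ t → u ≠ s → w u = v u := fun u h1 h2 => by simp [hw, h1, h2]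
  have hmem : ∀ u, w u ∈ Submodule.span ℤ (Set.range w) :=
    fun u => Submodule.subset_span ⟨u, rfl⟩
  have hort_ts : polar f (w t) (w s) = 1 := by
    rw [hwt, hws]
    simp only [hf.polar_add_left, hf.polar_add_right, hf.polar_zsmul_left, hf.polar_zsmul_right,
      hort t s hts, hort s t hts.symm, hf.polar_self, hat, hbs, one_zpow, mul_one, one_mul,
      ← zpow_mul, ← zpow_natCast, ← zpow_add]
    convert zpow_zero ζ using 2
    push_cast
    ring
  have hort_u : ∀ u, u ≠ t → u ≠ s → polar f (w t) (w u) = 1 ∧ polar f (w s) (w u) = 1 := by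
    intro u h1 h2
    rw [hwt, hws, hwu u h1 h2]
    simp only [hf.polar_add_left, hf.polar_zsmul_left, hort t u h1.symm, hort s u h2.symm,
      one_zpow, mul_one, and_self]
  refine ⟨w, hv.of_mem_span (fun u => ?_) fun u => ?_, ?_, ?_, hwu⟩
  · rcases eq_or_ne u t with rfl | h1
    · rw [hwt, smul_add, smul_comm, smul_comm (Q u) y, hv.nsmul_eq_zero, ← hQts,
        hv.nsmul_eq_zero]
      simp
    rcases eq_or_ne u s with rfl | h2
    · rw [hws, smul_add, smul_comm, smul_comm (Q u) (a * x), hv.nsmul_eq_zero, hQts,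
        hv.nsmul_eq_zero]
      simp
    · rw [hwu u h1 h2, hv.nsmul_eq_zero]
  · have hone : ∀ u, Q u = Q t → (a * x ^ 2 + b * y ^ 2) • v u = v u := fun u hu => by
      have := hv.zsmul_eq_zero (t := u) (hu ▸ hxy)
      rwa [sub_smul, one_smul, sub_eq_zero] at this
    rcases eq_or_ne u t with rfl | h1
    · have h := Submodule.sub_mem _ (Submodule.smul_mem _ (a * x) (hmem u))
        (Submodule.smul_mem _ y (hmem s))
      have e : (a * x) • w u - y • w s = (a * x ^ 2 + b * y ^ 2) • v u := by
        rw [hwt, hws]; module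
      rwa [e, hone u rfl] at h
    rcases eq_or_ne u s with rfl | h2
    · have h := Submodule.add_mem _ (Submodule.smul_mem _ (b * y) (hmem t))
        (Submodule.smul_mem _ x (hmem u))
      have e : (b * y) • w t + x • w u = (a * x ^ 2 + b * y ^ 2) • v u := by
        rw [hwt, hws]; module
      rwa [e, hone u hQts] at h
    · exact hwu u h1 h2 ▸ hmem u
  · intro u r hur
    by_cases h1 : u = t
    · subst h1
      by_cases h2 : r = s
      · exact h2 ▸ hort_ts
      · exact (hort_u r hur.symm h2).1
    by_cases h2 : u = s
    · subst h2
      by_cases h3 : r = t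
      · rw [h3, polar_comm, hort_ts]
      · exact (hort_u r h3 hur.symm).2
    by_cases h3 : r = t
    · rw [h3, polar_comm, (hort_u u h1 h2).1]
    by_cases h4 : r = s
    · rw [h4, polar_comm, (hort_u u h1 h2).2]
    rw [hwu u h1 h2, hwu r h3 h4, hort u r hur]
  · rw [hwt, map_add_eq f, hf.zsmul, hf.zsmul, hf.polar_zsmul_left, hf.polar_zsmul_right,
      hort t s hts, one_zpow, one_zpow, mul_one, hat, hbs, ← zpow_mul, ← zpow_mul, ← zpow_add]
    have h := (hζ.zpow_eq_one_iff_dvd _).mpr hxy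
    rwa [zpow_sub, zpow_one, mul_inv_eq_one] at h

variable [Fintype T]

lemma pow_value_ne_one [Finite G] (hf : IsMetric f) (hp : ∀ t, (p t).Prime)
    (hQ : ∀ t, Q t = p t ^ (l t + 1)) (hcard : Nat.card G = ∏ t, Q t)
    (hv : IsCyclicBasis Q v) (hort : IsOrthogonal f v) (t : T) : f (v t) ^ p t ^ l t ≠ 1 := by
  intro h
  have hQ0 : ∀ t, Q t ≠ 0 := fun t => by rw [hQ t]; exact pow_ne_zero _ (hp t).ne_zero
  have hzero : ((p t ^ l t : ℕ) : ℤ) • v t = 0 := by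
    rw [natCast_zsmul]
    refine hf.eq_zero_of_polar_basis hv fun s => ?_
    rw [hf.polar_nsmul_left]
    rcases eq_or_ne t s with rfl | hts
    · rw [hf.polar_self, ← pow_mul, mul_comm, pow_mul, h, one_pow]
    · rw [hort t s hts, one_pow]
  rw [hv.zsmul_eq_zero_iff hQ0 hcard, hQ t, Int.natCast_dvd_natCast,
    Nat.pow_dvd_pow_iff_le_right (hp t).one_lt] at hzero
  omega

lemma exists_values_of_orthogonal [Finite G] (hf : IsMetric f) (hp : ∀ t, (p t).Prime)
    (hodd : ∀ t, Odd (Q t)) (hQ : ∀ t, Q t = p t ^ (l t + 1)) (hcard : Nat.card G = ∏ t, Q t)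
    (hv : IsCyclicBasis Q v) (hort : IsOrthogonal f v) {ζ : T → Circle}
    (hζ : ∀ t, IsPrimitiveRoot (ζ t) (Q t)) :
    ∃ a : T → ℤ, ∀ t, f (v t) = ζ t ^ a t ∧ ¬ (p t : ℤ) ∣ a t := by
  have hQ0 : ∀ t, NeZero (Q t) := fun t => ⟨(hodd t).pos.ne'⟩
  suffices h : ∀ t, ∃ a : ℤ, f (v t) = ζ t ^ a ∧ ¬ (p t : ℤ) ∣ a by
    choose a ha using h
    exact ⟨a, ha⟩
  intro t
  obtain ⟨m, hm⟩ := exists_pow_eq_of_isPrimitiveRoot (hζ t)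
    (hf.pow_eq_one_of_nsmul_eq_zero (hodd t) (hv.nsmul_eq_zero t))
  refine ⟨m, by rw [zpow_natCast, hm], fun hdvd => ?_⟩
  obtain ⟨c, rfl⟩ := Int.natCast_dvd_natCast.mp hdvd
  apply pow_value_ne_one hf hp hQ hcard hv hort t
  rw [← hm, ← pow_mul, mul_right_comm, ← pow_succ', ← hQ t, pow_mul, (hζ t).pow_eq_one, one_pow]

lemma exists_equiv_of_values_eq [Finite G] (hf : IsMetric f) (hg : IsMetric g)
    (hQ : ∀ t, Q t ≠ 0) (hcard : Nat.card G = ∏ t, Q t)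
    (hv : IsCyclicBasis Q v) (hort : IsOrthogonal f v)
    (hw : IsCyclicBasis Q w) (hort' : IsOrthogonal g w) (h : ∀ t, f (v t) = g (w t)) :
    ∃ φ : G ≃+ G, ∀ x, g x = f (φ x) := by
  classical
  let ev := AddEquiv.ofBijective hv.hom (hv.hom_bijective hQ hcard)
  let ew := AddEquiv.ofBijective hw.hom (hw.hom_bijective hQ hcard)
  refine ⟨ew.symm.trans ev, fun x => ?_⟩
  obtain ⟨m, rfl⟩ := hw.exists_eq_sum x
  have hew : ew.symm (∑ t, m t • w t) = fun t => (m t : ZMod (Q t)) := by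
    rw [AddEquiv.symm_apply_eq]
    exact (hw.hom_intCast m).symm
  rw [AddEquiv.trans_apply, hew]
  change _ = f (hv.hom _)
  rw [hv.hom_intCast, hf.map_sum_of_orthogonal hort, hg.map_sum_of_orthogonal hort']
  exact prod_congr rfl fun t _ => by rw [h]

lemma IsMetric.polar_sum_sum_of_orthogonal (hf : IsMetric f) (hort : IsOrthogonal f v)
    (c d : T → ℤ) :
    polar f (∑ t, c t • v t) (∑ t, d t • v t) = ∏ t, f (v t) ^ (2 * (c t * d t)) := by
  rw [hf.polar_sum_left]
  refine prod_congr rfl fun t _ => ?_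
  rw [hf.polar_sum_right, prod_eq_single t]
  · rw [hf.polar_zsmul_left, hf.polar_zsmul_right, hf.polar_self, ← zpow_natCast, ← zpow_mul,
      ← zpow_mul]
    congr 1
    push_cast
    ring
  · intro s _ hs
    rw [hf.polar_zsmul_left, hf.polar_zsmul_right, hort t s hs.symm, one_zpow, one_zpow]
  · simp

end DiagonalForms

section Invariant

lemma zpow_sum {ι : Type*} (z : Circle) (S : Finset ι) (m : ι → ℤ) :
    z ^ (∑ s ∈ S, m s) = ∏ s ∈ S, z ^ m s :=
  map_sum (zmultiplesHom (Additive Circle) (.ofMul z)) m S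

lemma prime_pow_dvd_mul_mul {p r l m : ℕ} (hp : p.Prime) (hr : r.Prime)
    (hne : r ^ (m + 1) ≠ p ^ (l + 1)) {c d : ℤ}
    (hc : ((r ^ (m + 1) : ℕ) : ℤ) ∣ (p ^ (l + 1) : ℕ) * c)
    (hd : ((r ^ (m + 1) : ℕ) : ℤ) ∣ (p ^ (l + 1) : ℕ) * d) :
    ((r ^ (m + 1) : ℕ) : ℤ) ∣ c * d * (p ^ l : ℕ) := by
  rcases eq_or_ne r p with rfl | hrp
  · rcases lt_or_ge m l with hml | hml
    · exact (Int.natCast_dvd_natCast.mpr (pow_dvd_pow r hml)).mul_left _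
    · obtain ⟨e, rfl⟩ := Nat.exists_eq_add_of_le hml
      have he : 1 ≤ e := Nat.one_le_iff_ne_zero.mpr (by rintro rfl; exact hne rfl)
      have hr0 : ((r ^ (l + 1) : ℕ) : ℤ) ≠ 0 := by exact_mod_cast pow_ne_zero _ hr.ne_zero
      have hsplit : ((r ^ (l + e + 1) : ℕ) : ℤ) = (r ^ (l + 1) : ℕ) * (r ^ e : ℕ) := by
        push_cast; ring
      rw [hsplit] at hc hd
      refine dvd_trans ?_ (mul_dvd_mul (mul_dvd_mul (Int.dvd_of_mul_dvd_mul_left hr0 hc)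
        (Int.dvd_of_mul_dvd_mul_left hr0 hd)) dvd_rfl)
      rw [← Nat.cast_mul, ← Nat.cast_mul, Int.natCast_dvd_natCast, ← pow_add, ← pow_add]
      exact pow_dvd_pow r (by omega)
  · have hcop : IsCoprime ((r ^ (m + 1) : ℕ) : ℤ) ((p ^ (l + 1) : ℕ) : ℤ) :=
      Nat.isCoprime_iff_coprime.mpr (Nat.Coprime.pow _ _ ((Nat.coprime_primes hr hp).mpr hrp))
    exact ((hcop.dvd_of_dvd_mul_left hc).mul_right _).mul_right _

variable {G I : Type*} [AddCommGroup G] [Fintype I] {f : G → Circle}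
  {q p l n : I → ℕ} {v w : (Σ i, Fin (n i)) → G}

/-- The discriminant of each homogeneous component is well defined up to squares modulo `p`. -/
theorem exists_sq_mul_prod_eq_prod [Finite G] (hf : IsMetric f) (hp : ∀ i, (p i).Prime)
    (hodd : ∀ i, Odd (p i)) (hq : ∀ i, q i = p i ^ (l i + 1)) (hinj : Function.Injective q)
    (hcard : Nat.card G = ∏ t : Σ i, Fin (n i), q t.1)
    {ζ : I → Circle} (hζ : ∀ i, IsPrimitiveRoot (ζ i) (q i))
    (hv : IsCyclicBasis (fun t => q t.1) v) (hort : IsOrthogonal f v)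
    (hw : IsCyclicBasis (fun t => q t.1) w) (hort' : IsOrthogonal f w)
    {a b : (Σ i, Fin (n i)) → ℤ} (ha : ∀ t, f (v t) = ζ t.1 ^ a t)
    (hb : ∀ t, f (w t) = ζ t.1 ^ b t) (i : I) :
    ∃ x : ZMod (p i), x ^ 2 * ∏ j, (a ⟨i, j⟩ : ZMod (p i)) = ∏ j, (b ⟨i, j⟩ : ZMod (p i)) := by
  classical
  have hq0 : ∀ i, q i ≠ 0 := fun i => by rw [hq i]; exact pow_ne_zero _ (hp i).ne_zero
  choose A hA using fun t => hv.exists_eq_sum (w t)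
  have hdvd : ∀ (j : Fin (n i)) t, (q t.1 : ℤ) ∣ (q i : ℤ) * A ⟨i, j⟩ t := fun j t => by
    refine (hv.sum_eq_zero_iff (fun t => hq0 t.1) hcard
      (fun t => (q i : ℤ) * A ⟨i, j⟩ t)).mp ?_ t
    simp_rw [mul_smul]
    rw [← smul_sum, hA, natCast_zsmul]
    exact hw.nsmul_eq_zero ⟨i, j⟩
  have hblock : ∀ j j' : Fin (n i), polar f (w ⟨i, j⟩) (w ⟨i, j'⟩) ^ ((p i ^ l i : ℕ) : ℤ) =
      ζ i ^ ((∑ s, 2 * (A ⟨i, j⟩ ⟨i, s⟩ * a ⟨i, s⟩ * A ⟨i, j'⟩ ⟨i, s⟩)) *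
        ((p i ^ l i : ℕ) : ℤ)) := by
    intro j j'
    rw [← hA, ← hA, hf.polar_sum_sum_of_orthogonal hort, Fintype.prod_sigma,
      ← prod_zpow, prod_eq_single i]
    · rw [zpow_mul, zpow_sum]
      congr 1
      refine prod_congr rfl fun s _ => ?_
      rw [ha, ← zpow_mul]
      congr 1
      ring
    · intro i' _ hi'
      rw [← prod_zpow]
      refine prod_eq_one fun s _ => ?_
      rw [ha, ← zpow_mul, ← zpow_mul, (hζ i').zpow_eq_one_iff_dvd]
      have h := prime_pow_dvd_mul_mul (hp i) (hp i') (l := l i) (m := l i')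
        (by rw [← hq, ← hq]; exact hinj.ne hi')
        (by rw [← hq, ← hq]; exact hdvd j ⟨i', s⟩) (by rw [← hq, ← hq]; exact hdvd j' ⟨i', s⟩)
      rw [← hq] at h
      have e : a ⟨i', s⟩ * (2 * (A ⟨i, j⟩ ⟨i', s⟩ * A ⟨i, j'⟩ ⟨i', s⟩) * ((p i ^ l i : ℕ) : ℤ)) =
        2 * a ⟨i', s⟩ * (A ⟨i, j⟩ ⟨i', s⟩ * A ⟨i, j'⟩ ⟨i', s⟩ * ((p i ^ l i : ℕ) : ℤ)) := by ring
      exact e ▸ h.mul_left _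
    · simp
  have := Fact.mk (hp i)
  have hcancel : ∀ m m' : ℤ, ζ i ^ (2 * m * ((p i ^ l i : ℕ) : ℤ)) =
      ζ i ^ (2 * m' * ((p i ^ l i : ℕ) : ℤ)) → (m : ZMod (p i)) = m' := by
    intro m m' h
    rw [← mul_inv_eq_one, ← zpow_neg, ← zpow_add, (hζ i).zpow_eq_one_iff_dvd, hq i] at h
    have e : 2 * m * ((p i ^ l i : ℕ) : ℤ) + -(2 * m' * ((p i ^ l i : ℕ) : ℤ)) =
        ((p i ^ l i : ℕ) : ℤ) * (2 * (m - m')) := by ring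
    rw [e, pow_succ, Nat.cast_mul] at h
    have h2 := Int.dvd_of_mul_dvd_mul_left
      (by exact_mod_cast pow_ne_zero _ (hp i).ne_zero) h
    have hcop : IsCoprime (p i : ℤ) 2 := by
      exact_mod_cast Nat.isCoprime_iff_coprime.mpr (Nat.coprime_two_right.mpr (hodd i))
    have h3 := hcop.dvd_of_dvd_mul_left h2
    rw [← ZMod.intCast_zmod_eq_zero_iff_dvd] at h3
    push_cast at h3
    exact sub_eq_zero.mp h3
  let M : Matrix (Fin (n i)) (Fin (n i)) (ZMod (p i)) :=
    Matrix.of fun j s => (A ⟨i, j⟩ ⟨i, s⟩ : ZMod (p i))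
  have hM : M * Matrix.diagonal (fun j => (a ⟨i, j⟩ : ZMod (p i))) * M.transpose =
      Matrix.diagonal (fun j => (b ⟨i, j⟩ : ZMod (p i))) := by
    ext j j'
    have h1 : (M * Matrix.diagonal (fun j => (a ⟨i, j⟩ : ZMod (p i))) * M.transpose) j j' =
        ((∑ s, A ⟨i, j⟩ ⟨i, s⟩ * a ⟨i, s⟩ * A ⟨i, j'⟩ ⟨i, s⟩ : ℤ) : ZMod (p i)) := by
      rw [Matrix.mul_apply]
      push_cast
      exact sum_congr rfl fun s _ => by rw [Matrix.mul_diagonal]; rfl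
    have h2 := hblock j j'
    rw [← mul_sum] at h2
    rw [h1]
    rcases eq_or_ne j j' with rfl | hjj
    · rw [Matrix.diagonal_apply_eq]
      refine hcancel _ _ (h2.symm.trans ?_)
      rw [hf.polar_self, hb, ← zpow_natCast, ← zpow_mul, ← zpow_mul, Nat.cast_two,
        mul_comm (2 : ℤ) (b _), mul_assoc]
    · rw [Matrix.diagonal_apply_ne _ hjj, ← Int.cast_zero]
      refine hcancel _ _ (h2.symm.trans ?_)
      rw [hort' _ _ (by simpa using hjj)]
      simp
  refine ⟨M.det, ?_⟩
  have hdet := congrArg Matrix.det hM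
  rw [Matrix.det_mul, Matrix.det_mul, Matrix.det_transpose, Matrix.det_diagonal,
    Matrix.det_diagonal] at hdet
  rw [← hdet]
  ring

end Invariant

section DiagForm

variable {G T : Type*} [AddCommGroup G] [Fintype T] {Q : T → ℕ}

/-- The diagonal form with coefficients `a` in the coordinates `y`. -/
noncomputable def diagForm (χ : ∀ t, AddChar (ZMod (Q t)) Circle) (a : T → ℤ)
    (y : ∀ t, G →+ ZMod (Q t)) (x : G) : Circle :=
  ∏ t, χ t (a t * y t x ^ 2)

variable {χ : ∀ t, AddChar (ZMod (Q t)) Circle} {a : T → ℤ} {y : ∀ t, G →+ ZMod (Q t)} {v : T → G}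

lemma polar_diagForm (g h : G) :
    polar (diagForm χ a y) g h = ∏ t, χ t (2 * a t * y t g * y t h) := by
  simp only [polar, diagForm, ← prod_inv_distrib, ← prod_mul_distrib, ← AddChar.map_neg_eq_inv,
    ← AddChar.map_add_eq_mul, map_add]
  exact prod_congr rfl fun t _ => by congr 1; ring

lemma polar_diagForm_basis (hy : ∀ t, y t (v t) = 1) (hy' : ∀ s t, s ≠ t → y s (v t) = 0)
    (g : G) (t : T) : polar (diagForm χ a y) g (v t) = χ t (2 * a t * y t g) := by
  rw [polar_diagForm, prod_eq_single t (fun s _ hs => by simp [hy' s t hs]) (by simp), hy, mul_one]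

lemma isOrthogonal_diagForm (hy : ∀ t, y t (v t) = 1) (hy' : ∀ s t, s ≠ t → y s (v t) = 0) :
    IsOrthogonal (diagForm χ a y) v := fun t s hts => by
  rw [polar_diagForm_basis hy hy', hy' s t hts.symm, mul_zero, AddChar.map_zero_eq_one]

lemma diagForm_basis (hy : ∀ t, y t (v t) = 1) (hy' : ∀ s t, s ≠ t → y s (v t) = 0) (t : T) :
    diagForm χ a y (v t) = χ t 1 ^ a t := by
  rw [diagForm, prod_eq_single t (fun s _ hs => by simp [hy' s t hs]) (by simp), hy,
    ← AddChar.map_zsmul_eq_zpow]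
  simp

lemma isMetric_diagForm (hχ : ∀ t, Function.Injective (χ t))
    (ha : ∀ t, IsUnit (2 * a t : ZMod (Q t))) (hy : ∀ t, y t (v t) = 1)
    (hy' : ∀ s t, s ≠ t → y s (v t) = 0) (hinj : ∀ g, (∀ t, y t g = 0) → g = 0) :
    IsMetric (diagForm χ a y) := by
  have hpol : ∀ g c, diagForm χ a y g * diagForm χ a y c * (diagForm χ a y (g + c))⁻¹ =
      (polar (diagForm χ a y) g c)⁻¹ := fun g c => by
    rw [map_add_eq (diagForm χ a y), mul_inv _ (polar _ _ _), mul_inv_cancel_left]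
  refine ⟨fun m g => ?_, fun g h c => ?_, fun g hg => hinj g fun t => ?_⟩
  · rw [diagForm, diagForm, ← prod_zpow]
    refine prod_congr rfl fun t _ => ?_
    rw [← AddChar.map_zsmul_eq_zpow, map_zsmul]
    congr 1
    simp only [zsmul_eq_mul]
    push_cast
    ring
  · rw [hpol, hpol, hpol, ← mul_inv, polar_diagForm, polar_diagForm, polar_diagForm,
      ← prod_mul_distrib]
    congr 1
    refine prod_congr rfl fun t _ => ?_
    rw [← AddChar.map_add_eq_mul, map_add]
    congr 1
    ring
  · have h := hg (v t)
    rw [hpol, inv_eq_one, polar_diagForm_basis hy hy', ← AddChar.map_zero_eq_one (χ t)] at h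
    exact (ha t).mul_right_eq_zero.mp (hχ t h)

lemma isCyclicBasis_of_coordinates (hy : ∀ t, y t (v t) = 1)
    (hy' : ∀ s t, s ≠ t → y s (v t) = 0) (hinj : ∀ g, (∀ t, y t g = 0) → g = 0) :
    IsCyclicBasis Q v := by
  classical
  refine ⟨fun t => hinj _ fun s => ?_, eq_top_iff.mpr fun g _ => ?_⟩
  · rcases eq_or_ne s t with rfl | h
    · simp [hy]
    · simp [hy' s t h]
  · choose m hm using fun t => ZMod.intCast_surjective (y t g)
    refine (Submodule.mem_span_range_iff_exists_fun ℤ).mpr ⟨m, ?_⟩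
    rw [← sub_eq_zero]
    refine hinj _ fun s => ?_
    rw [map_sub, map_sum, sum_eq_single s (fun t _ ht => by simp [hy' s t ht.symm]) (by simp),
      map_zsmul, hy, zsmul_one, hm, sub_self]

end DiagForm

section NormalForm

variable {G I : Type*} [AddCommGroup G] {f g : G → Circle}
  {q p l n : I → ℕ} {ζ : I → Circle} {u : I → ℤ} {z : ∀ i, Fin (n i)} {ε ε' : I → Bool}

/-- Coefficients of the normal form: `u i` at the distinguished index `z i` of each component with
`ε i = true`, and `1` elsewhere. -/
def normalCoeff (u : I → ℤ) (z : ∀ i, Fin (n i)) (ε : I → Bool) (t : Σ i, Fin (n i)) : ℤ :=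
  if t.2 = z t.1 ∧ ε t.1 then u t.1 else 1

/-- `f` is diagonal with coefficients `normalCoeff u z ε` in some cyclic basis. -/
def HasNormalBasis (q : I → ℕ) (ζ : I → Circle) (u : I → ℤ) (z : ∀ i, Fin (n i)) (ε : I → Bool)
    (f : G → Circle) : Prop :=
  ∃ v : (Σ i, Fin (n i)) → G, IsCyclicBasis (fun t => q t.1) v ∧ IsOrthogonal f v ∧
    ∀ t, f (v t) = ζ t.1 ^ normalCoeff u z ε t

lemma HasNormalBasis.comp (h : HasNormalBasis q ζ u z ε f) (φ : G ≃+ G)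
    (hg : ∀ x, g x = f (φ x)) : HasNormalBasis q ζ u z ε g := by
  obtain ⟨v, hv, hort, hval⟩ := h
  obtain rfl : g = fun x => f (φ x) := funext hg
  refine ⟨fun t => φ.symm (v t), hv.map φ.symm, fun t s hts => ?_, fun t => ?_⟩
  · rw [polar_comp_equiv]
    simpa using hort t s hts
  · simpa using hval t

variable [Fintype I]

lemma HasNormalBasis.unique [Finite G] (hf : IsMetric f) (hp : ∀ i, (p i).Prime)
    (hodd : ∀ i, Odd (p i)) (hq : ∀ i, q i = p i ^ (l i + 1)) (hinj : Function.Injective q)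
    (hcard : Nat.card G = ∏ t : Σ i, Fin (n i), q t.1)
    (hζ : ∀ i, IsPrimitiveRoot (ζ i) (q i)) (hu : ∀ i, ¬ IsSquare (u i : ZMod (p i)))
    (h : HasNormalBasis q ζ u z ε f) (h' : HasNormalBasis q ζ u z ε' f) : ε = ε' := by
  classical
  have hprod : ∀ (ε : I → Bool) i, ∏ j, (normalCoeff u z ε ⟨i, j⟩ : ZMod (p i)) =
      if ε i then (u i : ZMod (p i)) else 1 := fun ε i => by
    rw [prod_eq_single (z i) (fun j _ hj => by simp [normalCoeff, hj]) (by simp)]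
    by_cases hε : ε i <;> simp [normalCoeff, hε]
  have key : ∀ ε ε' : I → Bool, HasNormalBasis q ζ u z ε f → HasNormalBasis q ζ u z ε' f →
      ∀ i, ε' i = true → ε i = true := by
    rintro ε ε' ⟨v, hv, hort, hval⟩ ⟨w, hw, hort', hval'⟩ i hi
    by_contra hε
    obtain ⟨x, hx⟩ := exists_sq_mul_prod_eq_prod hf hp hodd hq hinj hcard hζ hv hort hw hort'
      hval hval' i
    rw [hprod, hprod, if_pos hi, if_neg hε, mul_one] at hx
    exact hu i ⟨x, by rw [← hx, pow_two]⟩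
  funext i
  exact Bool.eq_iff_iff.mpr ⟨key ε' ε h' h i, key ε ε' h h' i⟩

lemma exists_hasNormalBasis [Finite G] (hf : IsMetric f) (hp : ∀ i, (p i).Prime)
    (hodd : ∀ i, Odd (p i)) (hq : ∀ i, q i = p i ^ (l i + 1))
    (hcard : Nat.card G = ∏ t : Σ i, Fin (n i), q t.1)
    (hζ : ∀ i, IsPrimitiveRoot (ζ i) (q i)) (hu : ∀ i, ¬ IsSquare (u i : ZMod (p i)))
    {v : (Σ i, Fin (n i)) → G} (hv : IsCyclicBasis (fun t => q t.1) v) :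
    ∃ ε, HasNormalBasis q ζ u z ε f := by
  classical
  have hqodd : ∀ t : Σ i, Fin (n i), Odd (q t.1) := fun t => by rw [hq]; exact (hodd _).pow
  obtain ⟨v, hv, hort⟩ := exists_orthogonal_basis hf (fun t => hp t.1) hqodd (fun t => hq t.1)
    hcard hv
  have hred : ∀ S : Finset (Σ i, Fin (n i)), ∃ v : (Σ i, Fin (n i)) → G,
      IsCyclicBasis (fun t => q t.1) v ∧ IsOrthogonal f v ∧
        ∀ t ∈ S, t.2 ≠ z t.1 → f (v t) = ζ t.1 := by
    intro S
    induction S using Finset.induction_on with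
    | empty => exact ⟨v, hv, hort, by simp⟩
    | insert t S ht ih =>
      obtain ⟨v, hv, hort, hval⟩ := ih
      by_cases htz : t.2 = z t.1
      · refine ⟨v, hv, hort, fun s hs hsz => ?_⟩
        rcases mem_insert.mp hs with rfl | hsS
        · exact absurd htz hsz
        · exact hval s hsS hsz
      obtain ⟨a, ha⟩ := exists_values_of_orthogonal hf (fun t => hp t.1) hqodd (fun t => hq t.1)
        hcard hv hort (fun t => hζ t.1)
      obtain ⟨w, hw, hort', hwt, hwu⟩ := exists_basis_value_eq hf (fun t => hp t.1) hqodd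
        (fun t => hq t.1) hv hort (t := t) (s := ⟨t.1, z t.1⟩)
        (fun h => htz (by rw [h])) rfl (hζ t.1) (ha t).1 (ha ⟨t.1, z t.1⟩).1
        (ha t).2 (ha ⟨t.1, z t.1⟩).2
      refine ⟨w, hw, hort', fun s hs hsz => ?_⟩
      rcases mem_insert.mp hs with rfl | hsS
      · exact hwt
      · rw [hwu s (by rintro rfl; exact ht hsS) (by rintro rfl; exact hsz rfl), hval s hsS hsz]
  obtain ⟨v, hv, hort, hval⟩ := hred univ
  obtain ⟨a, ha⟩ := exists_values_of_orthogonal hf (fun t => hp t.1) hqodd (fun t => hq t.1)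
    hcard hv hort (fun t => hζ t.1)
  choose ε s hs hsa using fun i => exists_mul_sq_eq_one_or (hp i) (hodd i) (l i) (hu i)
    (ha ⟨i, z i⟩).2
  let c : (Σ i, Fin (n i)) → ℤ := fun t => if t.2 = z t.1 then s t.1 else 1
  have hc : ∀ t : Σ i, Fin (n i), ¬ (p t.1 : ℤ) ∣ c t := fun t => by
    by_cases ht : t.2 = z t.1
    · simpa [c, ht] using hs t.1
    · simp only [c, ht, if_false]
      intro h
      have := Int.le_of_dvd one_pos h
      have := (hp t.1).two_le
      omega
  refine ⟨ε, fun t => c t • v t, hv.zsmul (fun t => hp t.1) (fun t => hq t.1) hc,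
    hort.zsmul hf c, fun t => ?_⟩
  rw [hf.zsmul]
  by_cases ht : t.2 = z t.1
  · obtain ⟨i, j⟩ := t
    obtain rfl : j = z i := ht
    have h := (hζ i).zpow_eq_one_iff_dvd _ |>.mpr (hq i ▸ hsa i)
    rw [zpow_sub, mul_inv_eq_one] at h
    rw [(ha _).1, ← zpow_mul]
    simpa [c, normalCoeff] using h
  · rw [hval t (mem_univ t) ht]
    simp [c, ht, normalCoeff]

end NormalForm

end MetricGroup

open MetricGroup

/-- If `G ≅ ⊕_{i=1}^{k} (ℤ/q_i)^{n_i}` with `q_1, …, q_k` distinct odd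
prime powers and `n_i ≥ 1`, then there are exactly `2^k` equivalence classes of
non-degenerate quadratic forms on `G` (i.e. of metric group structures `(G, q)` up to
isomorphism). -/
theorem stmt14 {G : Type*} [AddCommGroup G] [Fintype G]
    (k : ℕ) (q : Fin k → ℕ) (n : Fin k → ℕ)
    (hq : ∀ i, IsPrimePow (q i)) (hqodd : ∀ i, Odd (q i))
    (hqinj : Function.Injective q) (hn : ∀ i, 1 ≤ n i)
    (hiso : Nonempty (G ≃+ ((i : Fin k) → (Fin (n i) → ZMod (q i))))) :
    Nat.card (Quot (fun
        (q₁ q₂ : {f : G → Circle //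
          (∀ (m : ℤ) (g : G), f (m • g) = f g ^ (m ^ 2)) ∧
          (∀ g h c : G,
            f (g + h) * f c * (f (g + h + c))⁻¹ =
              (f g * f c * (f (g + c))⁻¹) * (f h * f c * (f (h + c))⁻¹)) ∧
          (∀ g : G, (∀ h, f g * f h * (f (g + h))⁻¹ = 1) → g = 0)}) =>
      ∃ φ : G ≃+ G, ∀ g, q₂.1 g = q₁.1 (φ g))) = 2 ^ k := by
  classical
  obtain ⟨e⟩ := hiso
  have hpl : ∀ i, ∃ p l : ℕ, p.Prime ∧ q i = p ^ (l + 1) := fun i => by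
    obtain ⟨p, l, hp, hl, h⟩ := (isPrimePow_nat_iff _).mp (hq i)
    exact ⟨p, l - 1, hp, by rw [Nat.sub_add_cancel hl, h]⟩
  choose p l hp hql using hpl
  have hpodd : ∀ i, Odd (p i) := fun i => Nat.Odd.of_mul_right (m := p i ^ l i)
    (by rw [← pow_succ, ← hql]; exact hqodd i)
  have hq0 : ∀ i, q i ≠ 0 := fun i => (hqodd i).pos.ne'
  choose u hu using fun i => exists_int_not_isSquare (hp i) (hpodd i)
  choose χ hχ using fun i => exists_addChar_injective (q i) (hq0 i)
  have hζ := fun i => isPrimitiveRoot_addChar_one (hχ i)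
  let z : ∀ i, Fin (n i) := fun i => ⟨0, hn i⟩
  have (i : Fin k) : NeZero (q i) := ⟨hq0 i⟩
  have hcard : Nat.card G = ∏ t : Σ i, Fin (n i), q t.1 := by
    rw [Nat.card_congr e.toEquiv, Nat.card_eq_fintype_card, Fintype.card_pi, Fintype.prod_sigma]
    simp [ZMod.card]
  let y : ∀ t : Σ i, Fin (n i), G →+ ZMod (q t.1) := fun t =>
    ((Pi.evalAddMonoidHom (fun _ => ZMod (q t.1)) t.2).comp
      (Pi.evalAddMonoidHom (fun i => Fin (n i) → ZMod (q i)) t.1)).comp e.toAddMonoidHom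
  let b : (Σ i, Fin (n i)) → G := fun t => e.symm (Pi.single t.1 (Pi.single t.2 1))
  have hy : ∀ t, y t (b t) = 1 := fun t => by simp [y, b]
  have hy' : ∀ s t, s ≠ t → y s (b t) = 0 := by
    rintro ⟨i, j⟩ ⟨i', j'⟩ h
    rcases eq_or_ne i i' with rfl | hi
    · have hj : j ≠ j' := by rintro rfl; exact h rfl
      simp [y, b, hj]
    · simp [y, b, hi]
  have hyinj : ∀ g, (∀ t, y t g = 0) → g = 0 := fun g hg => by
    rw [← map_eq_zero_iff e e.injective]
    funext i j
    exact hg ⟨i, j⟩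
  have hb : IsCyclicBasis (fun t : Σ i, Fin (n i) => q t.1) b :=
    isCyclicBasis_of_coordinates hy hy' hyinj
  have hunit : ∀ (ε : Fin k → Bool) (t : Σ i, Fin (n i)),
      IsUnit (2 * normalCoeff u z ε t : ZMod (q t.1)) := by
    intro ε t
    have hpi := Fact.mk (hp t.1)
    have hu0 : ¬ (p t.1 : ℤ) ∣ u t.1 := fun h => hu t.1 <| by
      rw [(ZMod.intCast_zmod_eq_zero_iff_dvd _ _).mpr h]; exact IsSquare.zero
    have hcop : IsCoprime ((q t.1 : ℕ) : ℤ) (2 * normalCoeff u z ε t) := by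
      refine IsCoprime.mul_right (by
        exact_mod_cast Nat.isCoprime_iff_coprime.mpr (Nat.coprime_two_right.mpr (hqodd t.1))) ?_
      unfold normalCoeff
      split_ifs
      · rw [hql, Nat.cast_pow]
        exact (((Nat.prime_iff_prime_int.mp (hp t.1)).coprime_iff_not_dvd).mpr hu0).pow_left
      · exact isCoprime_one_right
    have := (ZMod.coe_int_isUnit_iff_isCoprime _ _).mpr hcop
    exact_mod_cast this
  let F : (Fin k → Bool) → G → Circle := fun ε =>
    diagForm (fun t : Σ i, Fin (n i) => χ t.1) (normalCoeff u z ε) y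
  have hF : ∀ ε, IsMetric (F ε) := fun ε =>
    isMetric_diagForm (fun t => hχ t.1) (hunit ε) hy hy' hyinj
  have hFn : ∀ ε, HasNormalBasis q (fun i => χ i 1) u z ε (F ε) := fun ε =>
    ⟨b, hb, isOrthogonal_diagForm hy hy', diagForm_basis hy hy'⟩
  let r := fun (q₁ q₂ : {f : G → Circle //
      (∀ (m : ℤ) (g : G), f (m • g) = f g ^ (m ^ 2)) ∧
      (∀ g h c : G,
        f (g + h) * f c * (f (g + h + c))⁻¹ =
          (f g * f c * (f (g + c))⁻¹) * (f h * f c * (f (h + c))⁻¹)) ∧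
      (∀ g : G, (∀ h, f g * f h * (f (g + h))⁻¹ = 1) → g = 0)}) =>
    ∃ φ : G ≃+ G, ∀ g, q₂.1 g = q₁.1 (φ g)
  have hr : Equivalence r := by
    refine ⟨fun f => ⟨.refl G, fun _ => rfl⟩, ?_, ?_⟩
    · rintro f g ⟨φ, hφ⟩
      exact ⟨φ.symm, fun x => by rw [hφ, AddEquiv.apply_symm_apply]⟩
    · rintro f g h ⟨φ, hφ⟩ ⟨ψ, hψ⟩
      exact ⟨ψ.trans φ, fun x => by rw [hψ, hφ, AddEquiv.trans_apply]⟩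
  change Nat.card (Quot r) = 2 ^ k
  let cls : (Fin k → Bool) → Quot r := fun ε =>
    Quot.mk r ⟨F ε, (hF ε).zsmul, (hF ε).biadd, (hF ε).nondeg⟩
  have hcls : Function.Bijective cls := by
    refine ⟨fun ε ε' h => ?_, fun c => ?_⟩
    · obtain ⟨φ, hφ⟩ := (hr.quot_mk_eq_iff _ _).mp h
      exact ((hFn ε).comp φ hφ).unique (hF ε') hp hpodd hql hqinj hcard hζ hu (hFn ε')
    · induction c using Quot.ind with | mk f => ?_
      have hf : IsMetric f.1 := ⟨f.2.1, f.2.2.1, f.2.2.2⟩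
      obtain ⟨ε, v, hv, hort, hval⟩ := exists_hasNormalBasis (z := z) hf hp hpodd hql hcard hζ hu hb
      obtain ⟨w, hw, hort', hval'⟩ := hFn ε
      exact ⟨ε, Quot.sound (exists_equiv_of_values_eq (hF ε) hf (fun t => hq0 t.1) hcard hw hort'
        hv hort fun t => (hval' t).trans (hval t).symm)⟩
  rw [← Nat.card_eq_of_bijective cls hcls, Nat.card_eq_fintype_card]
  simp
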